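/- Let ι : SO(3) ↪ SU(3) be the inclusion of real special orthogonal 3×3 matrices into SU(3). The image of the induced homomorphism ι₊ : π₃(SO(3), 1) → π₃(SU(3), 1) on third homotopy groups equals the subgroup {x⁴ : x ∈ π₃(SU(3), 1)} of fourth powers of elements of π₃(SU(3), 1). (In particular, since π₃(SU(3)) ≅ ℤ, the image is the index-4 subgroup.) -/

import Mathlib

open Matrix
open scoped Topology Topology.Homotopy

noncomputable section

/-- The special unitary group `SU(n)`, i.e. the group of unitary `n×n` complex matrices of
determinant one, as a subgroup of the unitary group (so that its topology is the subspace
topology from the `n×n` complex matrices). -/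
def SU (n : ℕ) : Subgroup (Matrix.unitaryGroup (Fin n) ℂ) :=
  (Matrix.detMonoidHom.comp (Matrix.unitaryGroup (Fin n) ℂ).subtype).ker

/-- The special orthogonal group `SO(n)`, i.e. the group of real orthogonal `n×n` matrices of
determinant one (with the subspace topology from the `n×n` real matrices). -/
def SOr (n : ℕ) : Subgroup (Matrix.unitaryGroup (Fin n) ℝ) :=
  (Matrix.detMonoidHom.comp (Matrix.unitaryGroup (Fin n) ℝ).subtype).ker

variable {n : ℕ}

private lemma star_mapMatrix (B : Matrix (Fin n) (Fin n) ℝ) :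
    star (Complex.ofRealHom.mapMatrix B) = Complex.ofRealHom.mapMatrix (star B) := by
  rw [Matrix.star_eq_conjTranspose, Matrix.star_eq_conjTranspose]
  ext i j
  simp [conjTranspose_apply, Matrix.map_apply, Complex.conj_ofReal]

/-- The inclusion of the real special orthogonal group `SO(n)` into `SU(n)`, given by the
entrywise inclusion `ℝ → ℂ`. -/
def soToSU (n : ℕ) (A : ↥(SOr n)) : ↥(SU n) := by
  refine ⟨⟨Complex.ofRealHom.mapMatrix A.1.1, ?_, ?_⟩, ?_⟩
  · rw [star_mapMatrix, ← _root_.map_mul, A.1.2.1, _root_.map_one]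
  · rw [star_mapMatrix, ← _root_.map_mul, A.1.2.2, _root_.map_one]
  · have hdet : A.1.1.det = 1 := MonoidHom.mem_ker.mp A.2
    refine MonoidHom.mem_ker.mpr ?_
    show (Complex.ofRealHom.mapMatrix A.1.1).det = 1
    rw [← RingHom.map_det, hdet, _root_.map_one]

lemma continuous_soToSU (n : ℕ) : Continuous (soToSU n) := by
  apply Continuous.subtype_mk
  apply Continuous.subtype_mk
  apply continuous_matrix
  intro i j
  simp only [RingHom.mapMatrix_apply, Matrix.map_apply]
  exact Complex.continuous_ofReal.comp
    ((continuous_subtype_val.comp continuous_subtype_val).matrix_elem i j)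

/-- The inclusion `SO(n) ↪ SU(n)` as a continuous map. -/
def soEmbedding (n : ℕ) : C(↥(SOr n), ↥(SU n)) :=
  ⟨soToSU n, continuous_soToSU n⟩

lemma soEmbedding_one (n : ℕ) : soEmbedding n 1 = 1 := by
  apply Subtype.ext
  apply Subtype.ext
  show Complex.ofRealHom.mapMatrix (1 : Matrix (Fin n) (Fin n) ℝ) = 1
  rw [_root_.map_one]

/-- The map on homotopy groups induced by a pointed continuous map. -/
def HomotopyGroup.induced {X Y : Type*} [TopologicalSpace X] [TopologicalSpace Y]
    (N : Type*) (f : C(X, Y)) {x : X} {y : Y} (hf : f x = y) :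
    HomotopyGroup N X x → HomotopyGroup N Y y :=
  Quotient.map
    (fun g => ⟨f.comp g.1, fun z hz => by
      simp only [ContinuousMap.comp_apply]
      rw [g.2 z hz, hf]⟩)
    (fun a b hab => hab.map fun H => H.compContinuousMap f)

namespace SU

theorem ext {A B : SU n} (h : ∀ i j, A.1.1 i j = B.1.1 i j) : A = B :=
  Subtype.ext <| Subtype.ext <| Matrix.ext h

/-- An element of `SU(n)` from a matrix with the defining properties. -/
def mk (M : Matrix (Fin n) (Fin n) ℂ) (hM : M * star M = 1) (hdet : M.det = 1) : SU n :=
  ⟨⟨M, Matrix.mem_unitaryGroup_iff.2 hM⟩, MonoidHom.mem_ker.2 hdet⟩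

theorem mul_star_self (A : SU n) : A.1.1 * star A.1.1 = 1 := Matrix.mem_unitaryGroup_iff.1 A.1.2

theorem star_mul_self (A : SU n) : star A.1.1 * A.1.1 = 1 := Matrix.mem_unitaryGroup_iff'.1 A.1.2

theorem det_eq_one (A : SU n) : A.1.1.det = 1 := MonoidHom.mem_ker.1 A.2

theorem val_mul (A B : SU n) : (A * B).1.1 = A.1.1 * B.1.1 := rfl

theorem val_inv (A : SU n) : (A⁻¹).1.1 = star A.1.1 := rfl

theorem val_one : (1 : SU n).1.1 = 1 := rfl

theorem continuous_of_entries {X : Type*} [TopologicalSpace X] {f : X → SU n}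
    (h : ∀ i j, Continuous fun x => (f x).1.1 i j) : Continuous f :=
  (continuous_matrix h).subtype_mk _ |>.subtype_mk _

@[fun_prop]
theorem continuous_entry (i j : Fin n) : Continuous fun A : SU n => A.1.1 i j :=
  (continuous_subtype_val.comp continuous_subtype_val).matrix_elem i j

theorem sum_normSq_column (A : SU n) (j : Fin n) : ∑ i, Complex.normSq (A.1.1 i j) = 1 := by
  have h := congr_fun₂ (star_mul_self A) j j
  simp only [Matrix.mul_apply, Matrix.star_apply, Matrix.one_apply_eq] at h
  have : ((∑ i, Complex.normSq (A.1.1 i j) : ℝ) : ℂ) = 1 := by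
    rw [← h]; push_cast
    exact Finset.sum_congr rfl fun i _ => Complex.normSq_eq_conj_mul_self
  exact_mod_cast this

end SU

/-- The Hermitian norm of a complex vector. -/
def hermNorm {ι : Type*} [Fintype ι] (v : ι → ℂ) : ℝ := √(∑ i, Complex.normSq (v i))

section hermNorm

variable {ι : Type*} [Fintype ι] (v : ι → ℂ)

theorem hermNorm_nonneg : 0 ≤ hermNorm v := Real.sqrt_nonneg _

theorem hermNorm_sq : hermNorm v ^ 2 = ∑ i, Complex.normSq (v i) :=
  Real.sq_sqrt (Finset.sum_nonneg fun _ _ => Complex.normSq_nonneg _)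

theorem star_dotProduct_self : star v ⬝ᵥ v = ((hermNorm v ^ 2 : ℝ) : ℂ) := by
  rw [hermNorm_sq, dotProduct]; push_cast
  exact Finset.sum_congr rfl fun i _ => Complex.normSq_eq_conj_mul_self.symm

@[fun_prop]
theorem continuous_hermNorm : Continuous (hermNorm : (ι → ℂ) → ℝ) := by
  unfold hermNorm
  have := Complex.continuous_normSq
  fun_prop

end hermNorm

/-- The vectors that are not of the form `-λ e₀` with `λ ≥ 0`. -/
def slitSpace (n : ℕ) : Set (Fin (n + 2) → ℂ) := {v | (hermNorm v : ℂ) + v 0 ≠ 0}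

theorem notMem_slitSpace_iff {v : Fin (n + 2) → ℂ} :
    v ∉ slitSpace n ↔ ∃ c : ℝ, 0 ≤ c ∧ v = Pi.single 0 (-c : ℂ) := by
  simp only [slitSpace, Set.mem_ofPred_eq, not_not]
  constructor
  · intro h
    refine ⟨hermNorm v, hermNorm_nonneg v, ?_⟩
    have h0 : v 0 = -(hermNorm v : ℂ) := by linear_combination h
    have hs := hermNorm_sq v
    rw [Fin.sum_univ_succ, h0, Complex.normSq_neg, Complex.normSq_ofReal] at hs
    have hz : ∑ i : Fin (n + 1), Complex.normSq (v i.succ) = 0 := by linear_combination -hs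
    rw [Finset.sum_eq_zero_iff_of_nonneg fun _ _ => Complex.normSq_nonneg _] at hz
    funext i
    refine Fin.cases ?_ (fun j => ?_) i
    · simp [h0]
    · simpa using hz j (Finset.mem_univ _)
  · rintro ⟨c, hc, rfl⟩
    have : hermNorm (Pi.single 0 (-c : ℂ) : Fin (n + 2) → ℂ) = c := by
      rw [hermNorm, Finset.sum_eq_single 0 (fun j _ hj => by simp [hj]) (by simp)]
      simp [Complex.normSq_ofReal, Real.sqrt_mul_self hc]
    simp [this]

theorem hermNorm_single {c : ℝ} (hc : 0 ≤ c) :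
    hermNorm (Pi.single 0 (c : ℂ) : Fin (n + 2) → ℂ) = c := by
  rw [hermNorm, Finset.sum_eq_single 0 (fun j _ hj => by simp [hj]) (by simp)]
  simp [Complex.normSq_ofReal, Real.sqrt_mul_self hc]

theorem mem_slitSpace_of_re_pos {v : Fin (n + 2) → ℂ} (h : 0 < (v 0).re) : v ∈ slitSpace n := by
  by_contra hv
  obtain ⟨c, hc, rfl⟩ := notMem_slitSpace_iff.1 hv
  simp at h
  linarith

theorem smul_mem_slitSpace {v : Fin (n + 2) → ℂ} (hv : v ∈ slitSpace n) {c : ℝ} (hc : 0 < c) :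
    (fun i => (c : ℂ) * v i) ∈ slitSpace n := by
  by_contra h
  obtain ⟨d, hd, h⟩ := notMem_slitSpace_iff.1 h
  refine notMem_slitSpace_iff.2 ⟨d / c, by positivity, ?_⟩ hv
  have hc' : (c : ℂ) ≠ 0 := by exact_mod_cast hc.ne'
  funext i
  have hi := congr_fun h i
  refine Fin.cases (fun hi => ?_) (fun j hi => ?_) i hi
  · simp only [Pi.single_eq_same] at hi ⊢
    push_cast
    field_simp
    linear_combination hi
  · simpa [hc'] using hi

theorem segment_mem_slitSpace {v : Fin (n + 2) → ℂ} (hv : v ∈ slitSpace n) {t : ℝ}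
    (h0 : 0 ≤ t) (h1 : t ≤ 1) :
    (fun i => (1 - t : ℂ) * v i + (Pi.single 0 (t : ℂ) : Fin (n + 2) → ℂ) i) ∈ slitSpace n := by
  obtain rfl | h1 := h1.eq_or_lt
  · exact mem_slitSpace_of_re_pos (by simp)
  by_contra h
  obtain ⟨d, hd, h⟩ := notMem_slitSpace_iff.1 h
  refine notMem_slitSpace_iff.2 ⟨(d + t) / (1 - t), div_nonneg (by linarith) (by linarith), ?_⟩ hv
  have hc' : (1 - t : ℂ) ≠ 0 := by
    have : (1 - t : ℝ) ≠ 0 := by linarith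
    exact_mod_cast this
  funext i
  have hi := congr_fun h i
  refine Fin.cases (fun hi => ?_) (fun j hi => ?_) i hi
  · simp only [Pi.single_eq_same] at hi ⊢
    push_cast
    field_simp
    linear_combination hi
  · simpa [hc'] using hi

/-- The unitary reflection carrying `-e₀` to the normalization of `v`. -/
def slitReflection (v : Fin (n + 2) → ℂ) : Matrix (Fin (n + 2)) (Fin (n + 2)) ℂ :=
  1 - ((hermNorm v : ℂ) * (hermNorm v + star (v 0)))⁻¹ •
    vecMulVec (v + Pi.single 0 (hermNorm v : ℂ)) (star (v + Pi.single 0 (hermNorm v : ℂ)))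

theorem hermNorm_ne_zero {v : Fin (n + 2) → ℂ} (hv : v ∈ slitSpace n) : (hermNorm v : ℂ) ≠ 0 := by
  intro h
  have h0 : hermNorm v = 0 := by exact_mod_cast h
  have hs := hermNorm_sq v
  rw [h0, zero_pow two_ne_zero, eq_comm,
    Finset.sum_eq_zero_iff_of_nonneg fun _ _ => Complex.normSq_nonneg _] at hs
  have : v 0 = 0 := by simpa using hs 0 (Finset.mem_univ _)
  exact hv (by simp [h0, this])

theorem slitReflection_mul_star {v : Fin (n + 2) → ℂ} (hv : v ∈ slitSpace n) :
    slitReflection v * star (slitReflection v) = 1 := by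
  have hr := hermNorm_ne_zero hv
  have hs : (hermNorm v : ℂ) + v 0 ≠ 0 := hv
  have hs' : (hermNorm v : ℂ) + star (v 0) ≠ 0 := by
    have := (map_ne_zero (starRingEnd ℂ)).2 hs
    simpa using this
  set r : ℂ := (hermNorm v : ℂ) with hrdef
  set y := v + Pi.single 0 r with hy
  have hrr : star r = r := by simp [hrdef]
  have hyy : star y ⬝ᵥ y = r * (2 * r + v 0 + star (v 0)) := by
    have h := star_dotProduct_self v
    rw [hy, star_add, add_dotProduct, dotProduct_add, dotProduct_add, h]
    simp only [dotProduct_single, Pi.star_single, single_dotProduct, Pi.star_apply, hrr,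
      Pi.single_eq_same]
    push_cast
    rw [← hrdef]
    ring
  have hstar : star (slitReflection v) =
      1 - (r * (r + v 0))⁻¹ • vecMulVec y (star y) := by
    rw [slitReflection, ← hrdef, ← hy, star_sub, star_one, star_smul]
    congr 2
    · simp [hrr]
    · ext i j
      simp [vecMulVec_apply, mul_comm, Matrix.star_apply]
  rw [hstar, slitReflection, ← hrdef, ← hy, sub_mul, mul_sub, mul_sub, one_mul, mul_one, one_mul,
    smul_mul_smul_comm, vecMulVec_mul_vecMulVec, hyy]
  ext i j
  simp only [Matrix.sub_apply, Matrix.smul_apply, vecMulVec_apply, smul_eq_mul, Pi.smul_apply]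
  field_simp
  ring

theorem slitReflection_apply_zero {v : Fin (n + 2) → ℂ} (hv : v ∈ slitSpace n)
    (i : Fin (n + 2)) : slitReflection v i 0 = -(v i / hermNorm v) := by
  have hr := hermNorm_ne_zero hv
  have hs : (hermNorm v : ℂ) + v 0 ≠ 0 := hv
  have hs' : (hermNorm v : ℂ) + star (v 0) ≠ 0 := by
    have := (map_ne_zero (starRingEnd ℂ)).2 hs
    simpa using this
  have hs'' : (starRingEnd ℂ) (v 0) + (hermNorm v : ℂ) ≠ 0 := by
    rw [add_comm]; exact hs'
  rw [slitReflection]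
  simp only [Matrix.sub_apply, Matrix.smul_apply, vecMulVec_apply, smul_eq_mul, Pi.star_apply,
    Pi.add_apply, Pi.single_eq_same, star_add, RCLike.star_def, Complex.conj_ofReal] at hs' ⊢
  refine Fin.cases ?_ (fun j => ?_) i
  · simp
    field_simp
    ring
  · simp
    field_simp
    ring

/-- The unitary matrix with first column the normalization of `v`. -/
def slitUnitary (v : Fin (n + 2) → ℂ) : Matrix (Fin (n + 2)) (Fin (n + 2)) ℂ :=
  slitReflection v * diagonal (fun i => if i = 0 then -1 else 1)

theorem slitUnitary_mul_star {v : Fin (n + 2) → ℂ} (hv : v ∈ slitSpace n) :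
    slitUnitary v * star (slitUnitary v) = 1 := by
  have hd : diagonal (fun i : Fin (n + 2) => if i = 0 then (-1 : ℂ) else 1) *
      star (diagonal (fun i : Fin (n + 2) => if i = 0 then (-1 : ℂ) else 1)) = 1 := by
    rw [star_eq_conjTranspose, diagonal_conjTranspose, diagonal_mul_diagonal, ← diagonal_one]
    congr 1
    funext i
    by_cases h : i = 0 <;> simp [h]
  rw [slitUnitary, star_mul, mul_assoc, ← mul_assoc (diagonal _), hd, one_mul,
    slitReflection_mul_star hv]

/-- The special unitary matrix with first column the normalization of `v`. -/
def slitMatrix (v : Fin (n + 2) → ℂ) : Matrix (Fin (n + 2)) (Fin (n + 2)) ℂ :=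
  slitUnitary v * diagonal (fun i => if i = 1 then star (slitUnitary v).det else 1)

theorem star_det_mul_det {v : Fin (n + 2) → ℂ} (hv : v ∈ slitSpace n) :
    star (slitUnitary v).det * (slitUnitary v).det = 1 := by
  have := congr_arg Matrix.det (slitUnitary_mul_star hv)
  rwa [det_mul, star_eq_conjTranspose, det_conjTranspose, det_one, mul_comm] at this

/-- A continuous section over the slit space of the first column map on the special unitary
group. -/
def slitSection (v : slitSpace n) : SU (n + 2) :=
  SU.mk (slitMatrix v.1)
    (by
      have h := star_det_mul_det v.2
      have hd : diagonal (fun i : Fin (n + 2) => if i = 1 then star (slitUnitary v.1).det else 1) *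
          star (diagonal (fun i : Fin (n + 2) =>
            if i = 1 then star (slitUnitary v.1).det else 1)) = 1 := by
        rw [star_eq_conjTranspose, diagonal_conjTranspose, diagonal_mul_diagonal, ← diagonal_one]
        congr 1
        funext i
        by_cases hi : i = 1
        · simpa [hi] using h
        · simp [hi]
      rw [slitMatrix, star_mul, mul_assoc, ← mul_assoc (diagonal _), hd, one_mul,
        slitUnitary_mul_star v.2])
    (by
      rw [slitMatrix, det_mul, det_diagonal, Finset.prod_ite_eq' Finset.univ, mul_comm]
      simpa using star_det_mul_det v.2)

theorem slitSection_apply_zero (v : slitSpace n) (i : Fin (n + 2)) :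
    (slitSection v).1.1 i 0 = v.1 i / hermNorm v.1 := by
  change slitMatrix v.1 i 0 = _
  simp [slitMatrix, slitUnitary, slitReflection_apply_zero v.2]

theorem slitSection_single {c : ℝ} (hc : 0 < c)
    (h : (Pi.single 0 (c : ℂ) : Fin (n + 2) → ℂ) ∈ slitSpace n) :
    slitSection ⟨Pi.single 0 (c : ℂ), h⟩ = 1 := by
  have hc' : (c : ℂ) ≠ 0 := by exact_mod_cast hc.ne'
  have hR : slitReflection (Pi.single 0 (c : ℂ) : Fin (n + 2) → ℂ) =
      diagonal (fun i => if i = 0 then -1 else 1) := by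
    rw [slitReflection, hermNorm_single hc.le]
    ext i j
    simp only [Matrix.sub_apply, Matrix.smul_apply, vecMulVec_apply, smul_eq_mul, Pi.star_apply,
      Pi.add_apply, diagonal_apply, Matrix.one_apply]
    by_cases hi : i = 0
    · subst hi
      by_cases hj : 0 = j
      · subst hj
        simp
        field_simp
        norm_num
      · simp [hj, Ne.symm hj]
    · by_cases hij : i = j
      · subst hij
        simp [hi]
      · simp [hi, hij]
  have hU : slitUnitary (Pi.single 0 (c : ℂ) : Fin (n + 2) → ℂ) = 1 := by
    rw [slitUnitary, hR, diagonal_mul_diagonal, ← diagonal_one]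
    congr 1
    funext i
    by_cases hi : i = 0 <;> simp [hi]
  refine SU.ext fun i j => ?_
  change slitMatrix _ i j = (1 : Matrix _ _ ℂ) i j
  rw [slitMatrix, hU]
  simp [← diagonal_one]

theorem continuous_slitSection : Continuous (slitSection : slitSpace n → SU (n + 2)) := by
  have h1 : Continuous fun v : slitSpace n => (hermNorm v.1 : ℂ) := by fun_prop
  have h2 : Continuous fun v : slitSpace n => star (v.1 0) :=
    ((continuous_apply 0).comp continuous_subtype_val).star
  have hR : Continuous fun v : slitSpace n => slitReflection v.1 := by
    unfold slitReflection
    refine continuous_const.sub (Continuous.smul (Continuous.inv₀ (h1.mul (h1.add h2)) ?_) ?_)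
    · intro v
      refine mul_ne_zero (hermNorm_ne_zero v.2) ?_
      have := (map_ne_zero (starRingEnd ℂ)).2 v.2
      simpa using this
    · have hy : Continuous fun v : slitSpace n =>
          v.1 + Pi.single 0 (hermNorm v.1 : ℂ) :=
        continuous_subtype_val.add ((continuous_single 0).comp h1)
      exact Continuous.matrix_vecMulVec hy hy.star
  have hU : Continuous fun v : slitSpace n => slitUnitary v.1 := by
    unfold slitUnitary
    exact hR.mul continuous_const
  have hM : Continuous fun v : slitSpace n => slitMatrix v.1 := by
    unfold slitMatrix
    refine hU.mul (Continuous.matrix_diagonal (continuous_pi fun i => ?_))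
    by_cases hi : i = 1
    · simpa [hi] using (Continuous.matrix_det hU).star
    · simp [hi, continuous_const]
  exact SU.continuous_of_entries fun i j => hM.matrix_elem i j

namespace SU

/-- The special unitary matrices fixing the first basis vector. -/
def Fixes (A : SU (n + 1)) : Prop := ∀ i, A.1.1 i 0 = (Pi.single 0 1 : Fin (n + 1) → ℂ) i

theorem Fixes.row {A : SU (n + 1)} (hA : Fixes A) (j : Fin (n + 1)) :
    A.1.1 0 j = (Pi.single 0 1 : Fin (n + 1) → ℂ) j := by
  have h := congr_fun₂ (star_mul_self A) 0 j
  simp only [Matrix.mul_apply, Matrix.star_apply, hA _] at h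
  rw [Finset.sum_eq_single 0 (fun b _ hb => by simp [hb]) (by simp)] at h
  rw [Pi.single_apply]
  simpa [Matrix.one_apply, eq_comm] using h

/-- The block matrix with blocks `1` and `A`. -/
def inclMatrix (A : Matrix (Fin n) (Fin n) ℂ) : Matrix (Fin (n + 1)) (Fin (n + 1)) ℂ :=
  Matrix.of (Fin.cons (Fin.cons 1 fun _ => 0) fun i => Fin.cons 0 fun j => A i j)

@[simp] theorem inclMatrix_zero_zero (A : Matrix (Fin n) (Fin n) ℂ) : inclMatrix A 0 0 = 1 := rfl
@[simp] theorem inclMatrix_zero_succ (A : Matrix (Fin n) (Fin n) ℂ) (j : Fin n) :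
    inclMatrix A 0 j.succ = 0 := rfl
@[simp] theorem inclMatrix_succ_zero (A : Matrix (Fin n) (Fin n) ℂ) (i : Fin n) :
    inclMatrix A i.succ 0 = 0 := rfl
@[simp] theorem inclMatrix_succ_succ (A : Matrix (Fin n) (Fin n) ℂ) (i j : Fin n) :
    inclMatrix A i.succ j.succ = A i j := rfl

theorem inclMatrix_mul (A B : Matrix (Fin n) (Fin n) ℂ) :
    inclMatrix (A * B) = inclMatrix A * inclMatrix B := by
  ext i j
  refine Fin.cases ?_ (fun i => ?_) i <;> refine Fin.cases ?_ (fun j => ?_) j <;>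
    simp [Matrix.mul_apply, Fin.sum_univ_succ]

theorem inclMatrix_one : inclMatrix (1 : Matrix (Fin n) (Fin n) ℂ) = 1 := by
  ext i j
  refine Fin.cases ?_ (fun i => ?_) i <;> refine Fin.cases ?_ (fun j => ?_) j <;>
    simp [Matrix.one_apply, Fin.succ_ne_zero, (Fin.succ_ne_zero _).symm]

theorem inclMatrix_star (A : Matrix (Fin n) (Fin n) ℂ) :
    star (inclMatrix A) = inclMatrix (star A) := by
  ext i j
  refine Fin.cases ?_ (fun i => ?_) i <;> refine Fin.cases ?_ (fun j => ?_) j <;>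
    simp [Matrix.star_apply]

theorem det_inclMatrix (A : Matrix (Fin n) (Fin n) ℂ) : (inclMatrix A).det = A.det := by
  rw [Matrix.det_succ_row_zero, Fin.sum_univ_succ]
  have : (inclMatrix A).submatrix Fin.succ Fin.succ = A := rfl
  simp [this]

/-- The block inclusion of `SU(n)` into `SU(n+1)`. -/
def incl (n : ℕ) : SU n →* SU (n + 1) where
  toFun A := mk (inclMatrix A.1.1)
    (by rw [inclMatrix_star, ← inclMatrix_mul, mul_star_self, inclMatrix_one])
    (by rw [det_inclMatrix, det_eq_one])
  map_one' := Subtype.ext <| Subtype.ext inclMatrix_one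
  map_mul' A B := Subtype.ext <| Subtype.ext <| inclMatrix_mul _ _

theorem val_incl (A : SU n) : (incl n A).1.1 = inclMatrix A.1.1 := rfl

theorem continuous_incl : Continuous (incl n) := by
  refine continuous_of_entries fun i j => ?_
  simp only [val_incl]
  refine Fin.cases ?_ (fun i => ?_) i <;> refine Fin.cases ?_ (fun j => ?_) j <;>
    simp <;> fun_prop

theorem fixes_incl (A : SU n) : Fixes (incl n A) := by
  intro i
  rw [val_incl]
  refine Fin.cases ?_ (fun i => ?_) i <;> simp

theorem fixes_one : Fixes (1 : SU (n + 1)) := by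
  simpa using fixes_incl (1 : SU n)

theorem inclMatrix_submatrix {A : SU (n + 1)} (hA : Fixes A) :
    inclMatrix (A.1.1.submatrix Fin.succ Fin.succ) = A.1.1 := by
  ext i j
  refine Fin.cases ?_ (fun i => ?_) i <;> refine Fin.cases ?_ (fun j => ?_) j <;>
    simp [hA _, hA.row]

theorem inclMatrix_injective : Function.Injective (inclMatrix (n := n)) := by
  intro A B h
  ext i j
  simpa using congr_fun₂ h i.succ j.succ

theorem incl_injective : Function.Injective (incl n) := fun _ _ h =>
  Subtype.ext <| Subtype.ext <| inclMatrix_injective <| congr_arg (fun A => A.1.1) h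

/-- The element of `SU(n)` obtained from one of `SU(n+1)` fixing the first basis vector. -/
def core (A : {A : SU (n + 1) // Fixes A}) : SU n :=
  mk (A.1.1.1.submatrix Fin.succ Fin.succ)
    (inclMatrix_injective (by
      rw [inclMatrix_mul, ← inclMatrix_star, inclMatrix_submatrix A.2, mul_star_self,
        inclMatrix_one]))
    (by rw [← det_inclMatrix, inclMatrix_submatrix A.2, det_eq_one])

theorem incl_core (A : {A : SU (n + 1) // Fixes A}) : incl n (core A) = A.1 :=
  Subtype.ext <| Subtype.ext <| inclMatrix_submatrix A.2

theorem continuous_core : Continuous (core : {A : SU (n + 1) // Fixes A} → SU n) :=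
  continuous_of_entries fun i j =>
    (continuous_entry i.succ j.succ).comp continuous_subtype_val

end SU

open scoped unitInterval

theorem ContinuousMap.HomotopicRel.of_map {X Y : Type*} [TopologicalSpace X] [TopologicalSpace Y]
    {f g : C(X, Y)} {S : Set X} (H : I × X → Y) (hH : Continuous H) (h0 : ∀ x, H (0, x) = f x)
    (h1 : ∀ x, H (1, x) = g x) (hS : ∀ t, ∀ x ∈ S, H (t, x) = f x) : f.HomotopicRel g S :=
  ⟨⟨⟨⟨H, hH⟩, h0, h1⟩, hS⟩⟩

namespace SU

theorem Fixes.inv {A : SU (n + 1)} (hA : Fixes A) : Fixes A⁻¹ := by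
  intro i
  rw [val_inv, Matrix.star_apply, hA.row, Pi.single_apply]
  split_ifs <;> simp

theorem hermNorm_column (A : SU n) (j : Fin n) : hermNorm (fun i => A.1.1 i j) = 1 := by
  rw [hermNorm, sum_normSq_column, Real.sqrt_one]

theorem fixes_of_column_eq {A B : SU (n + 1)} (h : ∀ i, A.1.1 i 0 = B.1.1 i 0) :
    Fixes (A⁻¹ * B) := by
  intro i
  rw [val_mul, val_inv, Matrix.mul_apply]
  simp only [← h]
  have := congr_fun₂ (star_mul_self A) i 0
  rw [Matrix.mul_apply] at this
  rw [this, Matrix.one_apply, Pi.single_apply]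

theorem exists_homotopicRel_of_column_mem {X : Type*} [TopologicalSpace X] (g : C(X, SU (n + 2)))
    (hg : ∀ x, (fun i => (g x).1.1 i 0) ∈ slitSpace n) :
    ∃ g' : C(X, SU (n + 2)), (∀ x, Fixes (g' x)) ∧ g.HomotopicRel g' {x | Fixes (g x)} := by
  let k : I × X → slitSpace n := fun p =>
    ⟨_, segment_mem_slitSpace (hg p.2) p.1.2.1 p.1.2.2⟩
  have hk : Continuous k := by
    refine Continuous.subtype_mk (continuous_pi fun i => ?_) _
    have h1 : Continuous fun p : I × X => ((p.1 : ℝ) : ℂ) := by fun_prop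
    have h2 : Continuous fun p : I × X => (g p.2).1.1 i 0 := by fun_prop
    exact ((continuous_const.sub h1).mul h2).add
      ((continuous_apply i).comp ((continuous_single 0).comp h1))
  let H : I × X → SU (n + 2) := fun p => slitSection (k p) * (slitSection (k (0, p.2)))⁻¹ * g p.2
  have hH : Continuous H := by
    have h1 := continuous_slitSection.comp hk
    have h2 : Continuous fun p : I × X => slitSection (k (0, p.2)) :=
      continuous_slitSection.comp (hk.comp (by fun_prop))
    exact (h1.mul h2.inv).mul (by fun_prop)
  have hk1 (x : X) : slitSection (k (1, x)) = 1 := by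
    have h : (k (1, x)).1 = Pi.single 0 ((1 : ℝ) : ℂ) := by
      funext i
      simp [k]
    have := slitSection_single one_pos (h ▸ (k (1, x)).2)
    rw [← this]
    congr 1
    exact Subtype.ext h
  have hk0 (x : X) : (k (0, x)).1 = fun i => (g x).1.1 i 0 := by
    funext i
    simp [k]
  refine ⟨⟨fun x => H (1, x), hH.comp (by fun_prop)⟩, fun x => ?_,
    .of_map H hH (fun x => by simp [H]) (fun x => rfl) fun t x hx => ?_⟩
  · change Fixes (H (1, x))
    simp only [H, hk1, one_mul]
    refine fixes_of_column_eq fun i => ?_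
    rw [slitSection_apply_zero, hk0, hermNorm_column]
    simp
  · have hc (t : I) : slitSection (k (t, x)) = 1 := by
      have h : (k (t, x)).1 = Pi.single 0 ((1 : ℝ) : ℂ) := by
        funext i
        have hx' : Fixes (g x) := hx
        simp only [k, hx' _, Pi.single_apply]
        split_ifs <;> simp
      have := slitSection_single one_pos (h ▸ (k (t, x)).2)
      rw [← this]
      congr 1
      exact Subtype.ext h
    simp [H, hc]

/-- A continuous map from a Euclidean space of small dimension to `ℂⁿ⁺²` can be approximated by one
avoiding the nonpositive multiples of the first basis vector. -/
theorem exists_approx_mem_slitSpace {E : Type*} [NormedAddCommGroup E] [NormedSpace ℝ E]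
    [FiniteDimensional ℝ E] (hE : Module.finrank ℝ E + 1 < 2 * (n + 2))
    {f : E → Fin (n + 2) → ℂ} (hf : Continuous f) {ε : ℝ} (hε : 0 < ε) :
    ∃ g : E → Fin (n + 2) → ℂ, Continuous g ∧ (∀ x, ‖g x - f x‖ < ε) ∧
      ∀ x, g x ∈ slitSpace n := by
  obtain ⟨P, hP, hPf, -⟩ := hf.exists_contDiff_approx 1 (ε := fun _ => ε / 2) continuous_const
    fun _ => by positivity
  let Q : E × ℝ → Fin (n + 2) → ℂ := fun p => P p.1 + p.2 • (Pi.single 0 1 : Fin (n + 2) → ℂ)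
  have hQ : ContDiff ℝ 1 Q :=
    (ContDiff.comp (n := 1) (mod_cast hP) contDiff_fst).add (contDiff_snd.smul contDiff_const)
  have hd := hQ.dense_compl_range_of_finrank_lt_finrank (by
    rw [Module.finrank_prod, Module.finrank_self, Module.finrank_pi_fintype]
    simpa [mul_comm] using hE)
  obtain ⟨δ, hδ, hδ0⟩ := Metric.dense_iff.1 hd 0 (ε / 2) (by positivity)
  refine ⟨fun x => P x - δ, hP.continuous.sub continuous_const, fun x => ?_, fun x => ?_⟩
  · have h1 := hPf x
    rw [dist_eq_norm] at h1
    have h2 : ‖δ‖ < ε / 2 := by simpa using hδ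
    calc ‖P x - δ - f x‖ = ‖(P x - f x) - δ‖ := by congr 1; abel
      _ ≤ ‖P x - f x‖ + ‖δ‖ := norm_sub_le _ _
      _ < ε := by linarith
  · by_contra h
    obtain ⟨c, -, hc⟩ := notMem_slitSpace_iff.1 h
    refine hδ0 ⟨(x, c), ?_⟩
    have : P x = δ + Pi.single 0 (-c : ℂ) := by
      rw [← hc]
      exact (add_sub_cancel δ (P x)).symm
    simp only [Q, this]
    funext i
    simp only [Pi.add_apply, Pi.smul_apply, Pi.single_apply]
    split_ifs <;> simp

theorem norm_entry_le_one (A : SU n) (i j : Fin n) : ‖A.1.1 i j‖ ≤ 1 := by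
  have h := sum_normSq_column A j
  have h1 : Complex.normSq (A.1.1 i j) ≤ 1 := by
    rw [← h]
    exact Finset.single_le_sum (f := fun i => Complex.normSq (A.1.1 i j))
      (fun _ _ => Complex.normSq_nonneg _) (Finset.mem_univ i)
  rw [Complex.normSq_eq_norm_sq] at h1
  nlinarith [norm_nonneg (A.1.1 i j)]

theorem exists_homotopicRel_column_mem {E : Type*} [NormedAddCommGroup E] [NormedSpace ℝ E]
    [FiniteDimensional ℝ E] (hE : Module.finrank ℝ E + 1 < 2 * (n + 2)) (f : C(E, SU (n + 2))) :
    ∃ g : C(E, SU (n + 2)), (∀ x, (fun i => (g x).1.1 i 0) ∈ slitSpace n) ∧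
      f.HomotopicRel g {x | Fixes (f x)} := by
  let u : E → Fin (n + 2) → ℂ := fun x i => (f x).1.1 i 0
  have hu : Continuous u := continuous_pi fun i => by fun_prop
  let ε : ℝ := 1 / (4 * (n + 2))
  have hε : 0 < ε := by positivity
  have hεn : (n + 2) * ε = 1 / 4 := by simp only [ε]; field_simp
  have hε4 : ε ≤ 1 / 4 := by
    rw [← hεn]
    have : (0 : ℝ) ≤ n := n.cast_nonneg
    nlinarith
  obtain ⟨P, hP, hPu, hPs⟩ := exists_approx_mem_slitSpace hE hu hε
  let φ : E → ℝ := fun x => min 1 (2 * ‖u x - Pi.single 0 1‖)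
  have hφ : Continuous φ := by fun_prop
  have hφ0 (x : E) : 0 ≤ φ x := le_min zero_le_one (by positivity)
  have hφ1 (x : E) : φ x ≤ 1 := min_le_left _ _
  -- the perturbed first column
  let h : I × E → Fin (n + 2) → ℂ := fun p i =>
    u p.2 i + ((p.1 : ℝ) * φ p.2 : ℝ) * (P p.2 i - u p.2 i)
  have hh : Continuous h := by
    refine continuous_pi fun i => ?_
    have h1 : Continuous fun p : I × E => u p.2 i := by fun_prop
    have h2 : Continuous fun p : I × E => P p.2 i := by fun_prop
    have h3 : Continuous fun p : I × E => (((p.1 : ℝ) * φ p.2 : ℝ) : ℂ) := by fun_prop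
    exact h1.add (h3.mul (h2.sub h1))
  let w : I × E → Fin (n + 2) → ℂ := fun p => star (f p.2).1.1 *ᵥ h p
  have hw : Continuous w := by
    refine continuous_pi fun i => ?_
    simp only [w, Matrix.mulVec, dotProduct, Matrix.star_apply]
    refine continuous_finsetSum _ fun j _ => ?_
    have h1 : Continuous fun p : I × E => (f p.2).1.1 j i := by fun_prop
    exact h1.star.mul ((continuous_apply j).comp hh)
  have hdiff (x : E) (i) : ‖P x i - u x i‖ ≤ ε :=
    (norm_le_pi_norm (P x - u x) i).trans (hPu x).le
  have hws (p : I × E) : w p ∈ slitSpace n := by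
    apply mem_slitSpace_of_re_pos
    have hsplit : w p 0 = 1 + ∑ j, star (u p.2 j) *
        (((p.1 : ℝ) * φ p.2 : ℝ) * (P p.2 j - u p.2 j)) := by
      have h1 := congr_fun₂ (star_mul_self (f p.2)) 0 0
      simp only [Matrix.mul_apply, Matrix.star_apply, Matrix.one_apply_eq] at h1
      rw [← h1, ← Finset.sum_add_distrib]
      simp only [w, Matrix.mulVec, dotProduct, Matrix.star_apply, h, u]
      exact Finset.sum_congr rfl fun j _ => by ring
    have hb : ‖∑ j, star (u p.2 j) * ((((p.1 : ℝ) * φ p.2 : ℝ) : ℂ) * (P p.2 j - u p.2 j))‖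
        ≤ 1 / 4 := by
      refine (norm_sum_le_of_le (f := fun j => _) Finset.univ (n := fun _ => ε) fun j _ => ?_).trans
        (by simp [← hεn])
      rw [norm_mul, norm_mul, norm_star, Complex.norm_real, Real.norm_of_nonneg
        (mul_nonneg p.1.2.1 (hφ0 _))]
      have h1 : ‖u p.2 j‖ ≤ 1 := norm_entry_le_one _ _ _
      have h2 : (p.1 : ℝ) * φ p.2 ≤ 1 := mul_le_one₀ p.1.2.2 (hφ0 _) (hφ1 _)
      have h3 : (p.1 : ℝ) * φ p.2 * ‖P p.2 j - u p.2 j‖ ≤ 1 * ε :=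
        mul_le_mul h2 (hdiff _ _) (norm_nonneg _) zero_le_one
      calc _ ≤ 1 * (1 * ε) := mul_le_mul h1 h3 (mul_nonneg (mul_nonneg p.1.2.1 (hφ0 _))
            (norm_nonneg _)) zero_le_one
        _ = ε := by ring
    have := (Complex.abs_re_le_norm _).trans hb
    rw [hsplit, Complex.add_re, Complex.one_re]
    linarith [abs_le.1 this]
  let s : I × E → slitSpace n := fun p => ⟨w p, hws p⟩
  let H : I × E → SU (n + 2) := fun p => f p.2 * slitSection (s p)
  have hH : Continuous H := by
    have h1 : Continuous fun p => slitSection (s p) :=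
      continuous_slitSection.comp (hw.subtype_mk _)
    exact Continuous.mul (by fun_prop) h1
  have hcol (p : I × E) (i) : (H p).1.1 i 0 = ((hermNorm (w p))⁻¹ : ℝ) * h p i := by
    have h1 : (f p.2).1.1 *ᵥ w p = h p := by
      simp only [w, Matrix.mulVec_mulVec, mul_star_self, Matrix.one_mulVec]
    have h2 := congr_fun h1 i
    simp only [Matrix.mulVec, dotProduct] at h2
    simp only [H, val_mul, Matrix.mul_apply, slitSection_apply_zero, s]
    rw [← h2, Finset.mul_sum]
    push_cast
    exact Finset.sum_congr rfl fun j _ => by ring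
  have hfix (p : I × E) (hp : p.1 = 0 ∨ Fixes (f p.2)) : slitSection (s p) = 1 := by
    have hhp : h p = u p.2 := by
      funext i
      obtain hp | hp := hp
      · simp [h, hp]
      · have : u p.2 = Pi.single 0 1 := funext hp
        simp [h, φ, this]
    have hwp : w p = Pi.single 0 ((1 : ℝ) : ℂ) := by
      funext i
      have h1 := congr_fun₂ (star_mul_self (f p.2)) i 0
      simp only [Matrix.mul_apply] at h1
      simp only [w, hhp, Matrix.mulVec, dotProduct, u, h1]
      simp [Matrix.one_apply, Pi.single_apply]
    have := slitSection_single one_pos (hwp ▸ hws p)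
    rw [← this]
    congr 1
    exact Subtype.ext hwp
  refine ⟨⟨fun x => H (1, x), hH.comp (by fun_prop)⟩, fun x => ?_,
    .of_map H hH (fun x => by simp [H, hfix (0, x) (Or.inl rfl)]) (fun x => rfl)
      fun t x hx => by simp [H, hfix (t, x) (Or.inr hx)]⟩
  have hpos : 0 < (hermNorm (w (1, x)))⁻¹ := by
    refine inv_pos.2 ((hermNorm_nonneg _).lt_of_ne fun h0 => ?_)
    exact hermNorm_ne_zero (hws (1, x)) (by simp [← h0])
  have hs : h (1, x) ∈ slitSpace n := by
    obtain hlt | hge := lt_or_ge (2 * ‖u x - Pi.single 0 1‖) 1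
    · apply mem_slitSpace_of_re_pos
      have h1 : ‖u x 0 - 1‖ < 1 / 2 := by
        have := norm_le_pi_norm (u x - Pi.single 0 1) 0
        simp only [Pi.sub_apply, Pi.single_eq_same] at this
        linarith
      have h2 := (Complex.abs_re_le_norm _).trans_lt h1
      have h3 := (Complex.abs_re_le_norm _).trans (hdiff x 0)
      have h4 : (h (1, x) 0).re = (u x 0).re + φ x * (P x 0 - u x 0).re := by
        simp [h, Complex.add_re, Complex.mul_re]
      rw [h4]
      have h5 : -ε ≤ φ x * (P x 0 - u x 0).re := by
        have := (abs_le.1 h3).1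
        nlinarith [hφ0 x, hφ1 x]
      have h6 := (abs_lt.1 h2).1
      rw [Complex.sub_re, Complex.one_re] at h6
      linarith
    · have : h (1, x) = P x := by
        funext i
        simp [h, φ, min_eq_left hge]
      rw [this]
      exact hPs x
  have := smul_mem_slitSpace hs hpos
  convert this using 1
  funext i
  exact hcol (1, x) i

theorem exists_homotopicRel_fixes {E : Type*} [NormedAddCommGroup E] [NormedSpace ℝ E]
    [FiniteDimensional ℝ E] (hE : Module.finrank ℝ E + 1 < 2 * (n + 2)) (f : C(E, SU (n + 2))) :
    ∃ g : C(E, SU (n + 2)), (∀ x, Fixes (g x)) ∧ f.HomotopicRel g {x | Fixes (f x)} := by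
  obtain ⟨g, hg, hfg⟩ := exists_homotopicRel_column_mem hE f
  obtain ⟨g', hg', hgg'⟩ := exists_homotopicRel_of_column_mem g hg
  refine ⟨g', hg', hfg.trans ?_⟩
  obtain ⟨G⟩ := hgg'
  refine .of_map G G.continuous G.apply_zero G.apply_one fun t x hx => G.eq_fst t ?_
  have hx' : Fixes (f x) := hx
  change Fixes (g x)
  rwa [← hfg.fst_eq_snd hx]

/-- The previous deformation for maps out of a retract `K` of a Euclidean space. -/
theorem exists_homotopicRel_incl {E K : Type*} [NormedAddCommGroup E] [NormedSpace ℝ E]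
    [FiniteDimensional ℝ E] [TopologicalSpace K] (i : C(K, E)) (r : C(E, K))
    (hri : ∀ x, r (i x) = x) (hE : Module.finrank ℝ E + 1 < 2 * (n + 2)) (f : C(K, SU (n + 2))) :
    ∃ g : C(K, SU (n + 1)),
      f.HomotopicRel (ContinuousMap.comp ⟨incl (n + 1), continuous_incl⟩ g) {x | Fixes (f x)} := by
  obtain ⟨g, hg, ⟨G⟩⟩ := exists_homotopicRel_fixes hE (f.comp r)
  refine ⟨⟨fun x => core ⟨g (i x), hg _⟩, continuous_core.comp (by fun_prop)⟩,
    .of_map (fun p => G (p.1, i p.2)) (by fun_prop) (fun x => ?_) (fun x => ?_) fun t x hx => ?_⟩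
  · simp [hri]
  · simp [incl_core]
  · have : i x ∈ {y | Fixes ((f.comp r) y)} := by simpa [hri] using hx
    simpa [hri] using G.eq_fst t this

/-- `SU(n)` is path-connected. -/
theorem joined_one : ∀ {n : ℕ} (A : SU (n + 1)), Joined 1 A
  | 0, A => by
    have : A = 1 := by
      refine ext fun i j => ?_
      have := det_eq_one A
      rw [show i = 0 from Fin.fin_one_eq_zero i, show j = 0 from Fin.fin_one_eq_zero j, val_one,
        Matrix.one_apply_eq, ← this]
      exact (Matrix.det_fin_one (A := A.1.1)).symm
    rw [this]
  | n + 1, A => by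
    obtain ⟨g, ⟨G⟩⟩ := exists_homotopicRel_incl (K := Fin 0 → ℝ) (.id _) (.id _) (fun _ => rfl)
      (by simp; omega) (ContinuousMap.const (Fin 0 → ℝ) A)
    have h1 : Joined A (incl (n + 1) (g 0)) :=
      ⟨{ toFun := fun t => G (t, 0)
         continuous_toFun := by fun_prop
         source' := G.apply_zero _
         target' := G.apply_one _ }⟩
    obtain ⟨γ⟩ := joined_one (g 0)
    have h2 : Joined 1 (incl (n + 1) (g 0)) :=
      ⟨(γ.map continuous_incl).cast (map_one _).symm rfl⟩
    exact h2.trans h1.symm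

end SU

/-- The homotopy class of a generalized loop. -/
def HomotopyGroup.mk {N X : Type*} [TopologicalSpace X] {x : X} (f : Ω^ N X x) :
    HomotopyGroup N X x := ⟦f⟧

namespace GenLoop

variable {N X Y G : Type*} [TopologicalSpace X] [TopologicalSpace Y] [TopologicalSpace G]

/-- The image of a generalized loop under a pointed continuous map. -/
def map (f : C(X, Y)) {x : X} {y : Y} (hf : f x = y) (g : Ω^ N X x) : Ω^ N Y y :=
  ⟨f.comp g.1, fun z hz => by rw [ContinuousMap.comp_apply, g.2 z hz, hf]⟩

theorem map_apply (f : C(X, Y)) {x : X} {y : Y} (hf : f x = y) (g : Ω^ N X x) (z : I^N) :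
    map f hf g z = f (g z) := rfl

theorem Homotopic.map {x : X} {y : Y} {g g' : Ω^ N X x} (h : Homotopic g g') (f : C(X, Y))
    (hf : f x = y) : Homotopic (map f hf g) (map f hf g') :=
  h.elim fun H => ⟨H.compContinuousMap f⟩

theorem homotopic_of_map {x : X} {f g : Ω^ N X x} (H : I × (I^N) → X) (hH : Continuous H)
    (h0 : ∀ y, H (0, y) = f y) (h1 : ∀ y, H (1, y) = g y)
    (hb : ∀ t, ∀ y ∈ Cube.boundary N, H (t, y) = x) : Homotopic f g :=
  .of_map H hH h0 h1 fun t y hy => (hb t y hy).trans (f.2 y hy).symm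

variable [Group G] [IsTopologicalGroup G]

/-- The pointwise product of generalized loops in a topological group. -/
def mul (f g : Ω^ N G 1) : Ω^ N G 1 :=
  ⟨f.1 * g.1, fun y hy => by rw [ContinuousMap.mul_apply, f.2 y hy, g.2 y hy, one_mul]⟩

theorem mul_apply (f g : Ω^ N G 1) (y : I^N) : mul f g y = f y * g y := rfl

theorem Homotopic.mul {f f' g g' : Ω^ N G 1} (hf : Homotopic f f') (hg : Homotopic g g') :
    Homotopic (mul f g) (mul f' g') := by
  obtain ⟨F⟩ := hf
  obtain ⟨K⟩ := hg
  refine homotopic_of_map (fun p => F p * K p) (by fun_prop) (fun y => ?_) (fun y => ?_)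
    fun t y hy => ?_
  · rw [F.apply_zero, K.apply_zero]; rfl
  · rw [F.apply_one, K.apply_one]; rfl
  · rw [F.eq_fst t hy, K.eq_fst t hy, f.2 y hy, g.2 y hy, one_mul]

/-- Conjugation by an element of the path component of `1` does not change the homotopy class. -/
theorem homotopic_of_conj {c : G} (hc : Joined 1 c) {f g : Ω^ N G 1}
    (h : ∀ y, g y = c * f y * c⁻¹) : Homotopic f g := by
  obtain ⟨γ⟩ := hc
  refine homotopic_of_map (fun p => γ p.1 * f p.2 * (γ p.1)⁻¹) ?_ (fun y => ?_) (fun y => ?_)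
    fun t y hy => ?_
  · have : Continuous f := f.1.continuous
    fun_prop
  · simp
  · simp [h]
  · simp [GenLoop.boundary f y hy]

variable [DecidableEq N] [Nonempty N]

/-- The product in the homotopy group of a topological group is the pointwise product. -/
theorem mk_mul_mk (f g : Ω^ N G 1) :
    HomotopyGroup.mk f * HomotopyGroup.mk g = HomotopyGroup.mk (mul f g) := by
  let i : N := Classical.arbitrary N
  have hspec (p q : Ω^ N G 1) : HomotopyGroup.mk p * HomotopyGroup.mk q =
      HomotopyGroup.mk (transAt i q p) :=
    HomotopyGroup.mul_spec
  have h1 : Homotopic (transAt i g const) g :=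
    Quotient.exact ((hspec const g).symm.trans (one_mul (HomotopyGroup.mk g)))
  have h2 : Homotopic (transAt i const f) f :=
    Quotient.exact ((hspec f const).symm.trans (mul_one (HomotopyGroup.mk f)))
  rw [hspec]
  refine Quotient.sound (Homotopic.trans ?_ (h2.mul h1))
  rw [show transAt i g f = mul (transAt i const f) (transAt i g const) from ?_]
  ext y
  rw [mul_apply]
  simp only [transAt, coe_copy]
  split_ifs <;> simp

theorem mk_pow_four (f : Ω^ N G 1) :
    HomotopyGroup.mk f ^ 4 = HomotopyGroup.mk (mul (mul f f) (mul f f)) := by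
  rw [← mk_mul_mk, ← mk_mul_mk, pow_succ, pow_succ, pow_two, mul_assoc]

end GenLoop

/-- The retraction of Euclidean space onto the unit cube. -/
def cubeRetraction (N : Type*) : C(N → ℝ, N → I) :=
  ⟨fun x i => Set.projIcc 0 1 zero_le_one (x i), by fun_prop⟩

/-- The inclusion of the unit cube into Euclidean space. -/
def cubeInclusion (N : Type*) : C(N → I, N → ℝ) :=
  ⟨fun x i => x i, by fun_prop⟩

theorem cubeRetraction_cubeInclusion {N : Type*} (x : N → I) :
    cubeRetraction N (cubeInclusion N x) = x :=
  funext fun i => Set.projIcc_val zero_le_one (x i)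

namespace SU

/-- `SU(n) → SU(n+1)` as a continuous map. -/
def inclMap (n : ℕ) : C(SU n, SU (n + 1)) := ⟨incl n, continuous_incl⟩

theorem inclMap_one (n : ℕ) : inclMap n 1 = 1 := map_one (incl n)

theorem exists_homotopic_map_incl {N : Type*} [Fintype N] (hN : Fintype.card N + 1 < 2 * (n + 2))
    (f : Ω^ N (SU (n + 2)) 1) :
    ∃ g : Ω^ N (SU (n + 1)) 1, GenLoop.Homotopic f (GenLoop.map (inclMap _) (inclMap_one _) g) := by
  obtain ⟨g, hg⟩ := exists_homotopicRel_incl (cubeInclusion N) (cubeRetraction N)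
    cubeRetraction_cubeInclusion (by simpa using hN) f.1
  have hb (y) (hy : y ∈ Cube.boundary N) : y ∈ {x | Fixes (f.1 x)} := by
    change Fixes (f.1 y)
    rw [f.2 y hy]
    exact fixes_one
  refine ⟨⟨g, fun y hy => incl_injective ?_⟩, hg.elim fun H =>
    ⟨H.toHomotopy, fun t y hy => H.eq_fst t (hb y hy)⟩⟩
  rw [map_one, ← f.2 y hy]
  exact (hg.fst_eq_snd (hb y hy)).symm

theorem homotopic_of_homotopic_map_incl {N : Type*} [Fintype N]
    (hN : Fintype.card N + 2 < 2 * (n + 2)) {f g : Ω^ N (SU (n + 1)) 1}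
    (h : GenLoop.Homotopic (GenLoop.map (inclMap _) (inclMap_one _) f)
      (GenLoop.map (inclMap _) (inclMap_one _) g)) : GenLoop.Homotopic f g := by
  obtain ⟨H⟩ := h
  obtain ⟨K, hK⟩ := exists_homotopicRel_incl (K := I × (N → I)) (E := ℝ × (N → ℝ))
    ⟨fun p => ((p.1 : ℝ), cubeInclusion N p.2), by fun_prop⟩
    ⟨fun p => (Set.projIcc 0 1 zero_le_one p.1, cubeRetraction N p.2), by fun_prop⟩
    (fun p => Prod.ext (Set.projIcc_val zero_le_one p.1) (cubeRetraction_cubeInclusion p.2))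
    (by simp; omega) H.toContinuousMap
  have key (p) (A : SU (n + 1)) (hp : H p = incl _ A) : K p = A := by
    refine incl_injective (Eq.trans ?_ hp)
    refine (hK.fst_eq_snd (x := p) ?_).symm
    change Fixes (H p)
    rw [hp]
    exact fixes_incl A
  refine GenLoop.homotopic_of_map K K.continuous (fun y => key _ _ ?_) (fun y => key _ _ ?_)
    fun t y hy => key _ _ ?_
  · exact H.apply_zero y
  · exact H.apply_one y
  · rw [map_one]
    exact (H.eq_fst t hy).trans (GenLoop.boundary _ y hy)

end SU

namespace SU

/-! ### The special unitary group `SU(2)` -/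

theorem star_eq_adjugate (A : SU n) : star A.1.1 = A.1.1.adjugate := by
  rw [← mul_one (star A.1.1), ← one_smul ℂ (1 : Matrix (Fin n) (Fin n) ℂ), ← det_eq_one A,
    ← Matrix.mul_adjugate, ← mul_assoc, star_mul_self, one_mul]

theorem two_zero_one (A : SU 2) : A.1.1 0 1 = -star (A.1.1 1 0) := by
  have h := congr_fun₂ (star_eq_adjugate A) 0 1
  rw [Matrix.adjugate_fin_two, Matrix.star_apply] at h
  simp [h]

theorem two_one_one (A : SU 2) : A.1.1 1 1 = star (A.1.1 0 0) := by
  have h := congr_fun₂ (star_eq_adjugate A) 0 0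
  rw [Matrix.adjugate_fin_two, Matrix.star_apply] at h
  simp [h]

/-- The real coordinates of an element of `SU(2)` viewed as a unit quaternion. -/
def quat (A : SU 2) : Fin 4 → ℝ :=
  ![(A.1.1 0 0).re, (A.1.1 1 0).im, -(A.1.1 1 0).re, (A.1.1 0 0).im]

theorem sum_sq_quat (A : SU 2) : ∑ i, quat A i ^ 2 = 1 := by
  rw [← sum_normSq_column A 0]
  simp [quat, Fin.sum_univ_succ, Complex.normSq_apply]
  ring

theorem quat_injective : Function.Injective quat := by
  intro A B h
  have h0 : A.1.1 0 0 = B.1.1 0 0 := Complex.ext (congr_fun h 0) (congr_fun h 3)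
  have h1 : A.1.1 1 0 = B.1.1 1 0 := Complex.ext (neg_injective (congr_fun h 2)) (congr_fun h 1)
  refine ext fun i j => ?_
  fin_cases i <;> fin_cases j
  · exact h0
  · exact (two_zero_one A).trans ((h1 ▸ rfl : _ = _).trans (two_zero_one B).symm)
  · exact h1
  · exact (two_one_one A).trans ((h0 ▸ rfl : _ = _).trans (two_one_one B).symm)

theorem exists_quat_eq {q : Fin 4 → ℝ} (hq : ∑ i, q i ^ 2 = 1) : ∃ A, quat A = q := by
  have hq' : q 0 ^ 2 + q 1 ^ 2 + q 2 ^ 2 + q 3 ^ 2 = 1 := by rw [← hq, Fin.sum_univ_four]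
  refine ⟨mk !![⟨q 0, q 3⟩, ⟨q 2, q 1⟩; ⟨-q 2, q 1⟩, ⟨q 0, -q 3⟩] ?_ ?_, ?_⟩
  · ext i j
    fin_cases i <;> fin_cases j <;>
      simp [Matrix.mul_apply, Fin.sum_univ_two, Complex.ext_iff] <;>
      constructor <;> linarith
  · simp [Matrix.det_fin_two, Complex.ext_iff]
    constructor <;> linarith
  · funext i
    fin_cases i <;> simp [quat, mk]

end SU

/-! ### The double covering of `SO(3)` -/

/-- The matrix of the rotation defined by a quaternion. -/
def rotMatrix (q : Fin 4 → ℝ) : Matrix (Fin 3) (Fin 3) ℝ :=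
  !![q 0 ^ 2 + q 1 ^ 2 - q 2 ^ 2 - q 3 ^ 2, 2 * (q 1 * q 2 + q 0 * q 3),
      2 * (q 1 * q 3 - q 0 * q 2);
    2 * (q 1 * q 2 - q 0 * q 3), q 0 ^ 2 - q 1 ^ 2 + q 2 ^ 2 - q 3 ^ 2,
      2 * (q 2 * q 3 + q 0 * q 1);
    2 * (q 1 * q 3 + q 0 * q 2), 2 * (q 2 * q 3 - q 0 * q 1),
      q 0 ^ 2 - q 1 ^ 2 - q 2 ^ 2 + q 3 ^ 2]

theorem rotMatrix_mul_star (q : Fin 4 → ℝ) :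
    rotMatrix q * star (rotMatrix q) = (∑ i, q i ^ 2) ^ 2 • (1 : Matrix (Fin 3) (Fin 3) ℝ) := by
  ext i j
  fin_cases i <;> fin_cases j <;>
    simp [rotMatrix, Matrix.mul_apply, Fin.sum_univ_succ] <;> ring

theorem det_rotMatrix (q : Fin 4 → ℝ) : (rotMatrix q).det = (∑ i, q i ^ 2) ^ 3 := by
  rw [Matrix.det_fin_three]
  simp [rotMatrix, Fin.sum_univ_succ]
  ring

theorem rotMatrix_quat_mul (A B : SU 2) : rotMatrix (SU.quat (A * B)) =
    rotMatrix (SU.quat A) * rotMatrix (SU.quat B) := by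
  ext i j
  fin_cases i <;> fin_cases j <;>
    simp [rotMatrix, SU.quat, Matrix.mul_apply, Fin.sum_univ_succ,
      SU.two_zero_one A, SU.two_one_one A, -Subgroup.coe_mul, -Submonoid.coe_mul] <;> ring

/-- The double covering homomorphism `SU(2) → SO(3)`. -/
def spinHom : SU 2 →* SOr 3 :=
  MonoidHom.mk' (fun A => ⟨⟨rotMatrix (SU.quat A), Matrix.mem_unitaryGroup_iff.2 (by
    rw [rotMatrix_mul_star, SU.sum_sq_quat, one_pow, one_smul])⟩, MonoidHom.mem_ker.2 (by
    change (rotMatrix (SU.quat A)).det = 1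
    rw [det_rotMatrix, SU.sum_sq_quat, one_pow])⟩)
    fun A B => Subtype.ext <| Subtype.ext <| rotMatrix_quat_mul A B

theorem val_spinHom (A : SU 2) : (spinHom A).1.1 = rotMatrix (SU.quat A) := rfl

theorem continuous_spinHom : Continuous spinHom := by
  refine ((continuous_matrix fun i j => ?_).subtype_mk _).subtype_mk _
  fin_cases i <;> fin_cases j <;> simp [rotMatrix, SU.quat] <;> fun_prop

/-- The symmetric matrix equal to `4 q qᵀ` when `R` is the rotation of a unit quaternion `q`. -/
def quatProducts (R : Matrix (Fin 3) (Fin 3) ℝ) : Matrix (Fin 4) (Fin 4) ℝ :=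
  !![1 + R 0 0 + R 1 1 + R 2 2, R 1 2 - R 2 1, R 2 0 - R 0 2, R 0 1 - R 1 0;
    R 1 2 - R 2 1, 1 + R 0 0 - R 1 1 - R 2 2, R 0 1 + R 1 0, R 0 2 + R 2 0;
    R 2 0 - R 0 2, R 0 1 + R 1 0, 1 - R 0 0 + R 1 1 - R 2 2, R 1 2 + R 2 1;
    R 0 1 - R 1 0, R 0 2 + R 2 0, R 1 2 + R 2 1, 1 - R 0 0 - R 1 1 + R 2 2]

theorem quatProducts_rotMatrix {q : Fin 4 → ℝ} (hq : ∑ i, q i ^ 2 = 1) (i j : Fin 4) :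
    quatProducts (rotMatrix q) i j = 4 * (q i * q j) := by
  have hq' : q 0 ^ 2 + q 1 ^ 2 + q 2 ^ 2 + q 3 ^ 2 = 1 := by rw [← hq, Fin.sum_univ_four]
  fin_cases i <;> fin_cases j <;> simp [quatProducts, rotMatrix] <;> linarith

theorem rotMatrix_eq_of_quatProducts {R : Matrix (Fin 3) (Fin 3) ℝ} {q : Fin 4 → ℝ}
    (h : ∀ i j, quatProducts R i j = 4 * (q i * q j)) :
    ∑ i, q i ^ 2 = 1 ∧ rotMatrix q = R := by
  simp only [Fin.forall_fin_succ, quatProducts] at h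
  simp at h
  constructor
  · simp only [Fin.sum_univ_four]
    linarith
  · ext i j
    fin_cases i <;> fin_cases j <;> simp [rotMatrix] <;> linarith

theorem quatProducts_mul (R : SOr 3) (i j k : Fin 4) :
    quatProducts R.1.1 i j * quatProducts R.1.1 i k =
      quatProducts R.1.1 i i * quatProducts R.1.1 j k := by
  have hR : R.1.1 * star R.1.1 = 1 := Matrix.mem_unitaryGroup_iff.1 R.1.2
  have hR' : star R.1.1 * R.1.1 = 1 := Matrix.mem_unitaryGroup_iff'.1 R.1.2
  have hdet : R.1.1.det = 1 := MonoidHom.mem_ker.1 R.2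
  have hadj : star R.1.1 = R.1.1.adjugate := by
    rw [← mul_one (star R.1.1), ← one_smul ℝ (1 : Matrix (Fin 3) (Fin 3) ℝ), ← hdet,
      ← Matrix.mul_adjugate, ← mul_assoc, hR', one_mul]
  rw [Matrix.adjugate_fin_three] at hadj
  generalize R.1.1 = M at *
  simp only [← Matrix.ext_iff, Fin.forall_fin_succ, Matrix.mul_apply, Fin.sum_univ_three,
    Matrix.star_apply, Matrix.one_apply] at hR hR' hadj
  simp at hR hR' hadj
  obtain ⟨⟨a1, a2, a3⟩, ⟨a4, a5, a6⟩, a7, a8, a9⟩ := hR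
  obtain ⟨⟨b1, b2, b3⟩, ⟨b4, b5, b6⟩, b7, b8, b9⟩ := hR'
  obtain ⟨⟨c1, c2, c3⟩, ⟨c4, c5, c6⟩, c7, c8, c9⟩ := hadj
  fin_cases i <;> fin_cases j <;> fin_cases k <;> simp [quatProducts] <;> linarith

theorem spinHom_surjective : Function.Surjective spinHom := by
  intro R
  let K := quatProducts R.1.1
  have hK : K 0 0 + K 1 1 + K 2 2 + K 3 3 = 4 := by
    simp [K, quatProducts]
    ring
  obtain ⟨i, hi⟩ : ∃ i, 0 < K i i := by
    by_contra! h
    linarith [h 0, h 1, h 2, h 3]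
  let q : Fin 4 → ℝ := fun j => K i j / (2 * √(K i i))
  have hq (j k) : K j k = 4 * (q j * q k) := by
    have h := quatProducts_mul R i j k
    have h2 := Real.mul_self_sqrt hi.le
    have h3 : √(K i i) ≠ 0 := (Real.sqrt_pos.2 hi).ne'
    simp only [q]
    field_simp
    linear_combination 4 * K j k * h2 - 4 * h
  obtain ⟨h1, h2⟩ := rotMatrix_eq_of_quatProducts hq
  obtain ⟨A, hA⟩ := SU.exists_quat_eq h1
  exact ⟨A, Subtype.ext <| Subtype.ext <| by rw [val_spinHom, hA, h2]⟩

theorem finite_ker_spinHom : (spinHom.ker : Set (SU 2)).Finite := by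
  refine Set.Finite.of_finite_image (f := SU.quat) ?_ SU.quat_injective.injOn
  refine (Set.toFinite {![1, 0, 0, 0], ![-1, 0, 0, 0]}).subset ?_
  rintro _ ⟨A, hA, rfl⟩
  have h : rotMatrix (SU.quat A) = 1 := congr_arg (fun R => R.1.1) (MonoidHom.mem_ker.1 hA)
  have hK (i j) := quatProducts_rotMatrix (SU.sum_sq_quat A) i j
  rw [h] at hK
  have h0 := hK 0 0
  have h1 : SU.quat A 1 = 0 := by simpa [quatProducts] using hK 1 1
  have h2 : SU.quat A 2 = 0 := by simpa [quatProducts] using hK 2 2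
  have h3 : SU.quat A 3 = 0 := by simpa [quatProducts] using hK 3 3
  have h0' : (SU.quat A 0 - 1) * (SU.quat A 0 + 1) = 0 := by
    simp [quatProducts] at h0
    linarith
  obtain h | h := mul_eq_zero.1 h0'
  · left
    funext i
    fin_cases i
    exacts [sub_eq_zero.1 h, h1, h2, h3]
  · right
    funext i
    fin_cases i
    exacts [eq_neg_of_add_eq_zero_left h, h1, h2, h3]

instance SU.instCompactSpace : CompactSpace (SU n) := by
  have hemb : Topology.IsEmbedding fun A : SU n => A.1.1 :=
    Topology.IsEmbedding.subtypeVal.comp Topology.IsEmbedding.subtypeVal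
  refine ⟨hemb.isCompact_iff.2 ?_⟩
  have hrange : (fun A : SU n => A.1.1) '' Set.univ = {M | M * star M = 1} ∩ {M | M.det = 1} := by
    ext M
    constructor
    · rintro ⟨A, -, rfl⟩
      exact ⟨SU.mul_star_self A, SU.det_eq_one A⟩
    · rintro ⟨h1, h2⟩
      exact ⟨SU.mk M h1 h2, trivial, rfl⟩
  have hclosed : IsClosed ((fun A : SU n => A.1.1) '' Set.univ) := by
    rw [hrange]
    exact (isClosed_eq (by fun_prop) continuous_const).inter
      (isClosed_eq (Continuous.matrix_det continuous_id) continuous_const)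
  refine IsCompact.of_isClosed_subset (isCompact_univ_pi fun i => isCompact_univ_pi fun j =>
    isCompact_closedBall (0 : ℂ) 1) hclosed ?_
  rintro _ ⟨A, -, rfl⟩ i - j -
  simpa using SU.norm_entry_le_one A i j

theorem isCoveringMap_spinHom : IsCoveringMap spinHom :=
  (Topology.IsQuotientMap.isQuotientCoveringMap_of_isDiscrete_ker_monoidHom
    (continuous_spinHom.isClosedMap.isQuotientMap continuous_spinHom spinHom_surjective)
    finite_ker_spinHom.isDiscrete).isCoveringMap

/-- Loops of dimension at least two lift along covering maps. -/
theorem IsCoveringMap.exists_genLoop_lift {N E X : Type*} [Finite N] [Nontrivial N]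
    [TopologicalSpace E] [TopologicalSpace X] {p : C(E, X)} (hp : IsCoveringMap p) {e : E} {x : X}
    (he : p e = x) (f : Ω^ N X x) : ∃ g : Ω^ N E e, GenLoop.map p he g = f := by
  obtain ⟨F, ⟨hF0, hF⟩, -⟩ := hp.existsUnique_continuousMap_lifts
    (f.1.comp (cubeRetraction N)) 0 e (by
      obtain ⟨i⟩ := (inferInstance : Nonempty N)
      refine he.trans (f.2 _ ⟨i, Or.inl ?_⟩).symm
      exact Set.projIcc_left zero_le_one)
  have hF' (y) : p (F y) = f (cubeRetraction N y) := congr_fun hF y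
  have hface (i : N) (c : ℝ) (hc : c = 0 ∨ c = 1) {y z : N → ℝ} (hy : y i = c) (hz : z i = c) :
      F y = F z := by
    have hconv : Convex ℝ {y : N → ℝ | y i = c} :=
      convex_hyperplane (f := fun y : N → ℝ => y i) ⟨fun _ _ => rfl, fun _ _ => rfl⟩ c
    have hx (y : N → ℝ) (hy : y i = c) : p (F y) = x := by
      rw [hF']
      refine f.2 _ ⟨i, ?_⟩
      obtain rfl | rfl := hc
      · left; simp [cubeRetraction, hy]
      · right; simp [cubeRetraction, hy]
    exact hp.constOn_of_comp hconv.isPreconnected F.continuous.continuousOn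
      (fun a ha a' ha' => (hx a ha).trans (hx a' ha').symm) hy hz
  have h0 (i : N) (y : N → ℝ) (hy : y i = 0) : F y = e :=
    (hface i 0 (Or.inl rfl) hy rfl).trans hF0
  refine ⟨⟨F.comp (cubeInclusion N), fun y ⟨i, hi⟩ => ?_⟩, GenLoop.ext _ _ fun y => ?_⟩
  · obtain hi | hi := hi
    · exact h0 i _ (by simp [cubeInclusion, hi])
    · obtain ⟨j, hj⟩ := exists_ne i
      classical
      refine (hface i 1 (Or.inr rfl) (z := Pi.single i 1) ?_ (by simp)).trans
        (h0 j _ (Pi.single_eq_of_ne hj 1))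
      simp [cubeInclusion, hi]
  · exact (hF' _).trans (congr_arg f (cubeRetraction_cubeInclusion y))

namespace SU

theorem val_mk (M : Matrix (Fin n) (Fin n) ℂ) (hM : M * star M = 1) (hdet : M.det = 1) :
    (mk M hM hdet).1.1 = M := rfl

/-- The block embedding `SU(2) → SU(4)` into the last two coordinates. -/
def block (A : SU 2) : SU 4 := incl 3 (incl 2 A)

theorem val_block (A : SU 2) : (block A).1.1 =
    !![1, 0, 0, 0;
    0, 1, 0, 0;
    0, 0, A.1.1 0 0, A.1.1 0 1;
    0, 0, A.1.1 1 0, A.1.1 1 1] := by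
  ext i j
  fin_cases i <;> fin_cases j <;> rfl

/-- The even permutation matrix moving the last two coordinates to the coordinates 0 and 1. -/
def blockSwap : SU 4 :=
  mk !![0, 0, 1, 0; 0, 0, 0, 1; 1, 0, 0, 0; 0, 1, 0, 0]
    (by ext i j; fin_cases i <;> fin_cases j <;> simp [Matrix.mul_apply, Fin.sum_univ_succ])
    (by simp [Matrix.det_succ_row_zero, Fin.sum_univ_succ, Fin.succAbove])

theorem val_conj_blockSwap (A : SU 2) : (blockSwap * block A * blockSwap⁻¹).1.1 =
    !![A.1.1 0 0, A.1.1 0 1, 0, 0;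
    A.1.1 1 0, A.1.1 1 1, 0, 0;
    0, 0, 1, 0;
    0, 0, 0, 1] := by
  rw [val_mul, val_mul, val_inv, val_block, blockSwap, val_mk]
  ext i j
  fin_cases i <;> fin_cases j <;> simp [Matrix.mul_apply, Fin.sum_univ_succ]

/-- The even permutation matrix moving the last two coordinates to the coordinates 0 and 2. -/
def leftEvenSwap : SU 4 :=
  mk !![0, 0, 1, 0; 0, 1, 0, 0; 0, 0, 0, 1; 1, 0, 0, 0]
    (by ext i j; fin_cases i <;> fin_cases j <;> simp [Matrix.mul_apply, Fin.sum_univ_succ])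
    (by simp [Matrix.det_succ_row_zero, Fin.sum_univ_succ, Fin.succAbove])

theorem val_conj_leftEvenSwap (A : SU 2) : (leftEvenSwap * block A * leftEvenSwap⁻¹).1.1 =
    !![A.1.1 0 0, 0, A.1.1 0 1, 0;
    0, 1, 0, 0;
    A.1.1 1 0, 0, A.1.1 1 1, 0;
    0, 0, 0, 1] := by
  rw [val_mul, val_mul, val_inv, val_block, leftEvenSwap, val_mk]
  ext i j
  fin_cases i <;> fin_cases j <;> simp [Matrix.mul_apply, Fin.sum_univ_succ]

/-- The even permutation matrix moving the last two coordinates to the coordinates 1 and 3. -/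
def leftOddSwap : SU 4 :=
  mk !![0, 1, 0, 0; 0, 0, 1, 0; 1, 0, 0, 0; 0, 0, 0, 1]
    (by ext i j; fin_cases i <;> fin_cases j <;> simp [Matrix.mul_apply, Fin.sum_univ_succ])
    (by simp [Matrix.det_succ_row_zero, Fin.sum_univ_succ, Fin.succAbove])

theorem val_conj_leftOddSwap (A : SU 2) : (leftOddSwap * block A * leftOddSwap⁻¹).1.1 =
    !![1, 0, 0, 0;
    0, A.1.1 0 0, 0, A.1.1 0 1;
    0, 0, 1, 0;
    0, A.1.1 1 0, 0, A.1.1 1 1] := by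
  rw [val_mul, val_mul, val_inv, val_block, leftOddSwap, val_mk]
  ext i j
  fin_cases i <;> fin_cases j <;> simp [Matrix.mul_apply, Fin.sum_univ_succ]

/-- The tensor square of the standard representation of `SU(2)`, as a product of four conjugate
block embeddings. -/
def tensorSquare (A : SU 2) : SU 4 :=
  (blockSwap * block A * blockSwap⁻¹) * block A *
    ((leftEvenSwap * block A * leftEvenSwap⁻¹) * (leftOddSwap * block A * leftOddSwap⁻¹))

theorem val_tensorSquare (A : SU 2) : (tensorSquare A).1.1 =
    !![A.1.1 0 0 * A.1.1 0 0, A.1.1 0 0 * A.1.1 0 1, A.1.1 0 1 * A.1.1 0 0, A.1.1 0 1 * A.1.1 0 1;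
    A.1.1 0 0 * A.1.1 1 0, A.1.1 0 0 * A.1.1 1 1, A.1.1 0 1 * A.1.1 1 0, A.1.1 0 1 * A.1.1 1 1;
    A.1.1 1 0 * A.1.1 0 0, A.1.1 1 0 * A.1.1 0 1, A.1.1 1 1 * A.1.1 0 0, A.1.1 1 1 * A.1.1 0 1;
    A.1.1 1 0 * A.1.1 1 0, A.1.1 1 0 * A.1.1 1 1, A.1.1 1 1 * A.1.1 1 0, A.1.1 1 1 * A.1.1 1 1] := by
  rw [tensorSquare, val_mul, val_mul _ (block A), val_mul (_ * _ * _) (_ * _ * _),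
    val_conj_blockSwap, val_conj_leftEvenSwap, val_conj_leftOddSwap, val_block]
  ext i j
  fin_cases i <;> fin_cases j <;> simp [Matrix.mul_apply, Fin.sum_univ_succ] <;> ring

/-- The matrix of a basis of `ℂ² ⊗ ℂ²` whose first vector is antisymmetric and whose remaining
vectors span the symmetric tensors. -/
def bellBasis : SU 4 :=
  mk ((⟨1 / 2, 1 / 2⟩ : ℂ) • !![0, -Complex.I, -1, 0; 1, 0, 0, Complex.I;
      -1, 0, 0, Complex.I; 0, Complex.I, -1, 0])
    (by
      ext i j
      fin_cases i <;> fin_cases j <;> simp [Matrix.mul_apply, Fin.sum_univ_succ, Complex.ext_iff]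
        <;> norm_num)
    (by
      rw [Matrix.det_smul]
      simp [Matrix.det_succ_row_zero, Fin.sum_univ_succ, Fin.succAbove, Complex.ext_iff, pow_succ]
      norm_num)

/-- The tensor square of the standard representation of `SU(2)` is the sum of the trivial
representation and the complexified rotation representation. -/
theorem bellBasis_mul_incl (A : SU 2) :
    bellBasis * incl 3 (soToSU 3 (spinHom A)) = tensorSquare A * bellBasis := by
  refine Subtype.ext <| Subtype.ext ?_
  rw [val_mul, val_mul, val_tensorSquare, bellBasis, val_mk, Matrix.smul_mul, Matrix.mul_smul]
  congr 1
  have hS : (incl 3 (soToSU 3 (spinHom A))).1.1 =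
    (!![1, 0, 0, 0;
      0, (rotMatrix (quat A) 0 0 : ℝ), (rotMatrix (quat A) 0 1 : ℝ), (rotMatrix (quat A) 0 2 : ℝ);
      0, (rotMatrix (quat A) 1 0 : ℝ), (rotMatrix (quat A) 1 1 : ℝ), (rotMatrix (quat A) 1 2 : ℝ);
      0, (rotMatrix (quat A) 2 0 : ℝ), (rotMatrix (quat A) 2 1 : ℝ),
        (rotMatrix (quat A) 2 2 : ℝ)] : Matrix (Fin 4) (Fin 4) ℂ) := by
    ext i j
    fin_cases i <;> fin_cases j <;> rfl
  rw [hS]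
  have hq : quat A 0 ^ 2 + quat A 1 ^ 2 + quat A 2 ^ 2 + quat A 3 ^ 2 = 1 := by
    rw [← sum_sq_quat A, Fin.sum_univ_four]
  have h00 : A.1.1 0 0 = ⟨quat A 0, quat A 3⟩ := rfl
  have h10 : A.1.1 1 0 = ⟨-quat A 2, quat A 1⟩ := Complex.ext (neg_neg _).symm rfl
  simp only [two_zero_one, two_one_one, h00, h10]
  generalize quat A = q at *
  ext i j
  fin_cases i <;> fin_cases j <;>
    simp [Matrix.mul_apply, Fin.sum_univ_succ, rotMatrix, Complex.ext_iff, pow_two] <;>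
    constructor <;> linarith

end SU

/-- The double covering `SU(2) → SO(3)` as a continuous map. -/
def spinMap : C(SU 2, SOr 3) := ⟨spinHom, continuous_spinHom⟩

theorem spinMap_one : spinMap 1 = 1 := map_one spinHom

/-- The pointwise conjugate of a generalized loop in a topological group. -/
def GenLoop.conj {N G : Type*} [TopologicalSpace G] [Group G] [IsTopologicalGroup G] (c : G)
    (f : Ω^ N G 1) : Ω^ N G 1 :=
  ⟨⟨fun y => c * f y * c⁻¹, by
    have : Continuous f := f.1.continuous
    fun_prop⟩, fun y hy => by
    change c * f.1 y * c⁻¹ = 1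
    rw [f.2 y hy, mul_one, mul_inv_cancel]⟩

theorem SU.homotopic_conj {N : Type*} (c : SU (n + 1)) (f : Ω^ N (SU (n + 1)) 1) :
    GenLoop.Homotopic f (GenLoop.conj c f) :=
  GenLoop.homotopic_of_conj (SU.joined_one c) fun _ => rfl

/-- Through the double covering `SU(2) → SO(3)`, the inclusion `SO(3) → SU(3)` acts on homotopy
classes as the fourth power of the block inclusion `SU(2) → SU(3)`. -/
theorem mk_map_soEmbedding_spinMap (f : Ω^ (Fin 3) (SU 2) 1) :
    HomotopyGroup.mk (GenLoop.map (soEmbedding 3) (soEmbedding_one 3)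
      (GenLoop.map spinMap spinMap_one f)) =
    HomotopyGroup.mk (GenLoop.map (SU.inclMap 2) (SU.inclMap_one 2) f) ^ 4 := by
  rw [GenLoop.mk_pow_four]
  refine Quotient.sound (SU.homotopic_of_homotopic_map_incl (n := 2) (by simp) ?_)
  let F : Ω^ (Fin 3) (SU 4) 1 := GenLoop.map (SU.inclMap 3) (SU.inclMap_one 3)
    (GenLoop.map (SU.inclMap 2) (SU.inclMap_one 2) f)
  let W : Ω^ (Fin 3) (SU 4) 1 :=
    GenLoop.mul (GenLoop.mul (GenLoop.conj SU.blockSwap F) F)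
      (GenLoop.mul (GenLoop.conj SU.leftEvenSwap F) (GenLoop.conj SU.leftOddSwap F))
  have hW : GenLoop.Homotopic W (GenLoop.mul (GenLoop.mul F F) (GenLoop.mul F F)) :=
    ((SU.homotopic_conj _ F).symm.mul (.refl F)).mul
      ((SU.homotopic_conj _ F).symm.mul (SU.homotopic_conj _ F).symm)
  refine (GenLoop.homotopic_of_conj (SU.joined_one SU.bellBasis) (g := W) fun y => ?_).trans ?_
  · exact eq_mul_inv_of_mul_eq (SU.bellBasis_mul_incl (f y)).symm
  · convert hW using 1
    refine GenLoop.ext _ _ fun y => ?_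
    exact (map_mul (SU.incl 3) _ _).trans (congr_arg₂ _ (map_mul _ _ _) (map_mul _ _ _))

/-- **Instantons in Partially Broken Gauge Groups**: the image of the map
`π₃(SO(3), 1) → π₃(SU(3), 1)` induced by the inclusion `SO(3) ↪ SU(3)` is the subgroup of
fourth powers of `π₃(SU(3), 1)` (the index of embedding is four). -/
theorem range_induced_pi3_SO3_to_SU3 :
    Set.range (HomotopyGroup.induced (Fin 3) (soEmbedding 3) (soEmbedding_one 3)) =
      Set.range fun x : π_ 3 (↥(SU 3)) 1 => x ^ 4 := by
  ext z
  constructor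
  · rintro ⟨y, rfl⟩
    obtain ⟨b, rfl⟩ := Quotient.exists_rep y
    obtain ⟨f, rfl⟩ := isCoveringMap_spinHom.exists_genLoop_lift (p := spinMap) spinMap_one b
    exact ⟨_, (mk_map_soEmbedding_spinMap f).symm⟩
  · rintro ⟨x, rfl⟩
    obtain ⟨g, rfl⟩ := Quotient.exists_rep x
    obtain ⟨f, hf⟩ := SU.exists_homotopic_map_incl (n := 1) (by simp) g
    refine ⟨HomotopyGroup.mk (GenLoop.map spinMap spinMap_one f),
      (mk_map_soEmbedding_spinMap f).trans ?_⟩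
    exact congr_arg (· ^ 4) (Quotient.sound hf : _ = HomotopyGroup.mk _).symm

end
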